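/- Fix 0 < q < 1, θ > 0 and σ > 0. The function t ↦ Re[f_0(θ + σ + it)] is periodic with period 2π/|log q|, decreasing on [0, -π/log q], and increasing on [π/log q, 0]. -/

import Mathlib

open Complex Real

/-- The infinite q-Pochhammer symbol `(a; q)_∞ = ∏_{k=0}^∞ (1 - a q^k)`. -/
noncomputable def qPoch (a q : ℂ) : ℂ := ∏' k : ℕ, (1 - a * q ^ k)

/-- The q-Gamma function `Γ_q(z) = (1-q)^{1-z} (q;q)_∞ / (q^z;q)_∞`. -/
noncomputable def qGamma (q : ℝ) (z : ℂ) : ℂ :=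
  ((1 - q : ℂ)) ^ ((1 : ℂ) - z) * qPoch (q : ℂ) (q : ℂ) / qPoch ((q : ℂ) ^ z) (q : ℂ)

/-- The q-digamma function `Ψ_q(z) = d/dz log Γ_q(z)`. -/
noncomputable def qDigamma (q : ℝ) (z : ℂ) : ℂ :=
  deriv (fun w => Complex.log (qGamma q w)) z

/-- `κ(q,θ) = Ψ'_q(θ) / ((log q)^2 q^θ)`. -/
noncomputable def kappaC (q θ : ℝ) : ℂ :=
  deriv (qDigamma q) (θ : ℂ) / (((Real.log q : ℂ)) ^ 2 * (q : ℂ) ^ (θ : ℂ))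

/-- `f(q,θ) = Ψ'_q(θ)/(log q)^2 - Ψ_q(θ)/log q - log(1-q)/log q`. -/
noncomputable def fC (q θ : ℝ) : ℂ :=
  deriv (qDigamma q) (θ : ℂ) / ((Real.log q : ℂ)) ^ 2
    - qDigamma q (θ : ℂ) / (Real.log q : ℂ)
    - (Real.log (1 - q) : ℂ) / (Real.log q : ℂ)

/-- `f₀(Z) = -f (log q) Z + κ q^Z + log((q^Z; q)_∞)`. -/
noncomputable def f0 (q θ : ℝ) (Z : ℂ) : ℂ :=
  -fC q θ * (Real.log q : ℂ) * Z + kappaC q θ * (q : ℂ) ^ Z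
    + Complex.log (qPoch ((q : ℂ) ^ Z) (q : ℂ))

lemma norm_cpow_mul_pow_le {q δ : ℝ} (hq0 : 0 < q) (hq1 : q < 1) (k : ℕ)
    {z : ℂ} (hz : δ ≤ z.re) : ‖(q : ℂ) ^ z * (q : ℂ) ^ k‖ ≤ q ^ δ * q ^ k := by
  rw [norm_mul, norm_pow, Complex.norm_cpow_eq_rpow_re_of_pos hq0, Complex.norm_real,
    Real.norm_of_nonneg hq0.le]
  gcongr ?_ * _
  exact Real.rpow_le_rpow_of_exponent_ge hq0 hq1.le hz

lemma norm_cpow_mul_pow_lt_one {q : ℝ} (hq0 : 0 < q) (hq1 : q < 1) (k : ℕ)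
    {z : ℂ} (hz : 0 < z.re) : ‖(q : ℂ) ^ z * (q : ℂ) ^ k‖ < 1 :=
  (norm_cpow_mul_pow_le hq0 hq1 k le_rfl).trans_lt <|
    mul_lt_one_of_nonneg_of_lt_one_left (by positivity)
      (Real.rpow_lt_one hq0.le hq1 hz) (pow_le_one₀ hq0.le hq1.le)

lemma one_sub_mem_slitPlane {u : ℂ} (hu : ‖u‖ < 1) : 1 - u ∈ Complex.slitPlane := by
  simpa [sub_eq_add_neg] using Complex.mem_slitPlane_of_norm_lt_one (z := -u) (by simpa using hu)

lemma one_sub_ne_zero {u : ℂ} (hu : ‖u‖ < 1) : 1 - u ≠ 0 :=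
  Complex.slitPlane_ne_zero (one_sub_mem_slitPlane hu)

lemma hasDerivAt_cpow_mul_pow {q : ℝ} (hq0 : 0 < q) (k : ℕ) (z : ℂ) :
    HasDerivAt (fun w : ℂ => (q : ℂ) ^ w * (q : ℂ) ^ k)
      (Real.log q * ((q : ℂ) ^ z * (q : ℂ) ^ k)) z := by
  have hq : (q : ℂ) ≠ 0 := by exact_mod_cast hq0.ne'
  have h := ((hasDerivAt_id z).const_cpow (c := (q : ℂ)) (Or.inl hq)).mul_const ((q : ℂ) ^ k)
  rw [← Complex.ofReal_log hq0.le] at h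
  refine h.congr_deriv ?_
  simp only [id]
  ring

lemma hasDerivAt_log_one_sub_cpow {q : ℝ} (hq0 : 0 < q) (hq1 : q < 1) (k : ℕ)
    {z : ℂ} (hz : 0 < z.re) :
    HasDerivAt (fun w : ℂ => Complex.log (1 - (q : ℂ) ^ w * (q : ℂ) ^ k))
      (-Real.log q * ((q : ℂ) ^ z * (q : ℂ) ^ k / (1 - (q : ℂ) ^ z * (q : ℂ) ^ k))) z := by
  have h := ((hasDerivAt_cpow_mul_pow hq0 k z).const_sub 1).clog
    (one_sub_mem_slitPlane (norm_cpow_mul_pow_lt_one hq0 hq1 k hz))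
  refine h.congr_deriv ?_
  ring

lemma hasDerivAt_div_one_sub_cpow {q : ℝ} (hq0 : 0 < q) (hq1 : q < 1) (k : ℕ)
    {z : ℂ} (hz : 0 < z.re) :
    HasDerivAt (fun w : ℂ => (q : ℂ) ^ w * (q : ℂ) ^ k / (1 - (q : ℂ) ^ w * (q : ℂ) ^ k))
      (Real.log q * ((q : ℂ) ^ z * (q : ℂ) ^ k / (1 - (q : ℂ) ^ z * (q : ℂ) ^ k) ^ 2)) z := by
  have hne := one_sub_ne_zero (norm_cpow_mul_pow_lt_one hq0 hq1 k hz)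
  have hd := hasDerivAt_cpow_mul_pow hq0 k z
  have h := hd.fun_div (hd.const_sub 1) hne
  refine h.congr_deriv ?_
  field_simp
  ring

lemma isOpen_lt_re (δ : ℝ) : IsOpen {z : ℂ | δ < z.re} :=
  isOpen_lt continuous_const Complex.continuous_re

lemma norm_log_one_sub_cpow_le {q δ : ℝ} (hq0 : 0 < q) (hq1 : q < 1) (hδ : 0 < δ) (k : ℕ)
    {z : ℂ} (hz : δ < z.re) :
    ‖Complex.log (1 - (q : ℂ) ^ z * (q : ℂ) ^ k)‖ ≤ ((1 - q ^ δ)⁻¹ + 1) * q ^ k := by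
  have hρ : q ^ δ < 1 := Real.rpow_lt_one hq0.le hq1 hδ
  have hρ0 : 0 < q ^ δ := by positivity
  have hk1 : q ^ k ≤ 1 := pow_le_one₀ hq0.le hq1.le
  have hk0 : 0 < q ^ k := by positivity
  have hlt := norm_cpow_mul_pow_lt_one hq0 hq1 k (hδ.trans hz)
  have hle := norm_cpow_mul_pow_le hq0 hq1 k hz.le
  have h := Complex.norm_log_one_add_le (z := -((q : ℂ) ^ z * (q : ℂ) ^ k)) (by rwa [norm_neg])
  rw [norm_neg, ← sub_eq_add_neg] at h
  set a := ‖(q : ℂ) ^ z * (q : ℂ) ^ k‖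
  have ha0 : 0 ≤ a := norm_nonneg _
  have hak : a ≤ q ^ k := by nlinarith
  have haρ : a ≤ q ^ δ := by nlinarith
  have hinv : (1 - a)⁻¹ ≤ (1 - q ^ δ)⁻¹ := inv_anti₀ (by linarith) (by linarith)
  have hinv0 : 0 < (1 - a)⁻¹ := inv_pos.2 (by linarith)
  have h2 : a ^ 2 ≤ q ^ k := by nlinarith
  have h3 : a ^ 2 * (1 - a)⁻¹ ≤ q ^ k * (1 - q ^ δ)⁻¹ := by gcongr
  have h4 : 0 ≤ a ^ 2 * (1 - a)⁻¹ := by positivity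
  linarith

lemma norm_div_one_sub_cpow_le {q δ : ℝ} (hq0 : 0 < q) (hq1 : q < 1) (hδ : 0 < δ) (k : ℕ)
    {z : ℂ} (hz : δ < z.re) :
    ‖(q : ℂ) ^ z * (q : ℂ) ^ k / (1 - (q : ℂ) ^ z * (q : ℂ) ^ k)‖ ≤ (1 - q ^ δ)⁻¹ * q ^ k := by
  have hρ : q ^ δ < 1 := Real.rpow_lt_one hq0.le hq1 hδ
  have hρ0 : 0 < q ^ δ := by positivity
  have hk1 : q ^ k ≤ 1 := pow_le_one₀ hq0.le hq1.le
  have hk0 : 0 < q ^ k := by positivity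
  have hle := norm_cpow_mul_pow_le hq0 hq1 k hz.le
  have hsub := norm_sub_norm_le (1 : ℂ) ((q : ℂ) ^ z * (q : ℂ) ^ k)
  rw [norm_one] at hsub
  rw [norm_div]
  calc _ ≤ q ^ k / (1 - q ^ δ) := by
        apply div_le_div₀ hk0.le _ (by linarith)
        · nlinarith
        · nlinarith
    _ = _ := by rw [div_eq_mul_inv, mul_comm]

/-- The series `∑ log (1 - q^{z+k})`, a branch of the logarithm of `(q^z; q)_∞` for `0 < re z`. -/
noncomputable def logPoch (q : ℝ) (z : ℂ) : ℂ :=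
  ∑' k : ℕ, Complex.log (1 - (q : ℂ) ^ z * (q : ℂ) ^ k)

lemma summable_log_one_sub_cpow {q : ℝ} (hq0 : 0 < q) (hq1 : q < 1) {z : ℂ} (hz : 0 < z.re) :
    Summable fun k : ℕ => Complex.log (1 - (q : ℂ) ^ z * (q : ℂ) ^ k) :=
  .of_norm_bounded ((summable_geometric_of_lt_one hq0.le hq1).mul_left _)
    fun k => norm_log_one_sub_cpow_le hq0 hq1 (half_pos hz) k (half_lt_self hz)

lemma exp_logPoch {q : ℝ} (hq0 : 0 < q) (hq1 : q < 1) {z : ℂ} (hz : 0 < z.re) :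
    Complex.exp (logPoch q z) = qPoch ((q : ℂ) ^ z) q :=
  Complex.cexp_tsum_eq_tprod
    (fun k => one_sub_ne_zero (norm_cpow_mul_pow_lt_one hq0 hq1 k hz))
    (summable_log_one_sub_cpow hq0 hq1 hz)

lemma hasDerivAt_logPoch {q : ℝ} (hq0 : 0 < q) (hq1 : q < 1) {z : ℂ} (hz : 0 < z.re) :
    HasDerivAt (logPoch q) (-Real.log q *
      ∑' k : ℕ, (q : ℂ) ^ z * (q : ℂ) ^ k / (1 - (q : ℂ) ^ z * (q : ℂ) ^ k)) z := by
  have hu := (summable_geometric_of_lt_one hq0.le hq1).mul_left ((1 - q ^ (z.re / 2))⁻¹ + 1)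
  have hd : ∀ k : ℕ, DifferentiableOn ℂ
      (fun w : ℂ => Complex.log (1 - (q : ℂ) ^ w * (q : ℂ) ^ k)) {w | z.re / 2 < w.re} :=
    fun k w hw => (hasDerivAt_log_one_sub_cpow hq0 hq1 k
      ((half_pos hz).trans hw)).differentiableAt.differentiableWithinAt
  have hb := fun (k : ℕ) (w : ℂ) (hw : w ∈ {w : ℂ | z.re / 2 < w.re}) =>
    norm_log_one_sub_cpow_le hq0 hq1 (half_pos hz) k hw
  have hmem : z ∈ {w : ℂ | z.re / 2 < w.re} := half_lt_self hz
  have hs := Complex.hasSum_deriv_of_summable_norm hu hd (isOpen_lt_re _) hb hmem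
  have hdiff := (Complex.differentiableOn_tsum_of_summable_norm hu hd
    (isOpen_lt_re _) hb).differentiableAt ((isOpen_lt_re _).mem_nhds hmem)
  simp only [(hasDerivAt_log_one_sub_cpow hq0 hq1 _ hz).deriv] at hs
  rw [← tsum_mul_left, hs.tsum_eq]
  exact hdiff.hasDerivAt

lemma hasSum_deriv_tsum_div_one_sub_cpow {q : ℝ} (hq0 : 0 < q) (hq1 : q < 1)
    {z : ℂ} (hz : 0 < z.re) :
    HasSum (fun k : ℕ =>
        Real.log q * ((q : ℂ) ^ z * (q : ℂ) ^ k / (1 - (q : ℂ) ^ z * (q : ℂ) ^ k) ^ 2))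
      (deriv (fun w : ℂ =>
        ∑' k : ℕ, (q : ℂ) ^ w * (q : ℂ) ^ k / (1 - (q : ℂ) ^ w * (q : ℂ) ^ k)) z) := by
  have hs := Complex.hasSum_deriv_of_summable_norm
    (F := fun (k : ℕ) (w : ℂ) => (q : ℂ) ^ w * (q : ℂ) ^ k / (1 - (q : ℂ) ^ w * (q : ℂ) ^ k))
    (U := {w : ℂ | z.re / 2 < w.re}) (z := z)
    ((summable_geometric_of_lt_one hq0.le hq1).mul_left _)
    (fun k w hw => (hasDerivAt_div_one_sub_cpow hq0 hq1 k
      ((half_pos hz).trans hw)).differentiableAt.differentiableWithinAt)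
    (isOpen_lt_re _) (fun k w hw => norm_div_one_sub_cpow_le hq0 hq1 (half_pos hz) k hw)
    (half_lt_self hz)
  simpa only [(hasDerivAt_div_one_sub_cpow hq0 hq1 _ hz).deriv] using hs

lemma qGamma_eq_exp {q : ℝ} (hq0 : 0 < q) (hq1 : q < 1) {z : ℂ} (hz : 0 < z.re) :
    qGamma q z =
      Complex.exp (Real.log (1 - q) * (1 - z) + logPoch q 1 - logPoch q z) := by
  have h1 : (1 - q : ℂ) ≠ 0 := by
    exact_mod_cast (sub_pos.2 hq1).ne'
  have hone := exp_logPoch hq0 hq1 (z := 1) (by simp)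
  rw [Complex.cpow_one] at hone
  rw [Complex.exp_sub, Complex.exp_add, exp_logPoch hq0 hq1 hz, hone, qGamma,
    Complex.cpow_def_of_ne_zero h1, Complex.ofReal_log (sub_pos.2 hq1).le]
  push_cast
  rfl

lemma logPoch_ofReal_im {q x : ℝ} (hq0 : 0 < q) (hq1 : q < 1) (hx : 0 < x) :
    (logPoch q x).im = 0 := by
  have h : logPoch q x = ((∑' k : ℕ, Real.log (1 - q ^ x * q ^ k) : ℝ) : ℂ) := by
    rw [logPoch, Complex.ofReal_tsum]
    refine tsum_congr fun k => ?_
    rw [Complex.ofReal_log]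
    · push_cast [Complex.ofReal_cpow hq0.le]
      rfl
    · have := mul_lt_one_of_nonneg_of_lt_one_left (Real.rpow_nonneg hq0.le x)
        (Real.rpow_lt_one hq0.le hq1 hx) (pow_le_one₀ hq0.le hq1.le (n := k))
      linarith
  rw [h, Complex.ofReal_im]

lemma qDigamma_eventuallyEq {q θ : ℝ} (hq0 : 0 < q) (hq1 : q < 1) (hθ : 0 < θ) :
    qDigamma q =ᶠ[nhds (θ : ℂ)] fun z => -Real.log (1 - q) + Real.log q *
      ∑' k : ℕ, (q : ℂ) ^ z * (q : ℂ) ^ k / (1 - (q : ℂ) ^ z * (q : ℂ) ^ k) := by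
  set G : ℂ → ℂ := fun z => Real.log (1 - q) * (1 - z) + logPoch q 1 - logPoch q z with hG
  have hGd : ∀ z : ℂ, 0 < z.re → HasDerivAt G (-Real.log (1 - q) + Real.log q *
      ∑' k : ℕ, (q : ℂ) ^ z * (q : ℂ) ^ k / (1 - (q : ℂ) ^ z * (q : ℂ) ^ k)) z := by
    intro z hz
    have h := (((((hasDerivAt_id z).const_sub 1).const_mul
      (Real.log (1 - q) : ℂ)).add_const (logPoch q 1)).sub (hasDerivAt_logPoch hq0 hq1 hz))
    refine h.congr_deriv ?_
    ring
  have hre : ∀ᶠ z : ℂ in nhds (θ : ℂ), 0 < z.re :=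
    (isOpen_lt_re 0).mem_nhds (by simpa using hθ)
  have hGθ : (G θ).im = 0 := by
    have h1 := logPoch_ofReal_im hq0 hq1 one_pos
    have h2 := logPoch_ofReal_im hq0 hq1 hθ
    rw [Complex.ofReal_one] at h1
    simp [hG, h1, h2]
  have hcont : ContinuousAt (fun z => (G z).im) θ :=
    Complex.continuous_im.continuousAt.comp (hGd θ (by simpa using hθ)).continuousAt
  have him : ∀ᶠ z : ℂ in nhds (θ : ℂ), (G z).im ∈ Set.Ioo (-Real.pi) Real.pi :=
    hcont.eventually_mem (Ioo_mem_nhds (by rw [hGθ]; linarith [Real.pi_pos])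
      (by rw [hGθ]; exact Real.pi_pos))
  have hlog : ∀ᶠ z : ℂ in nhds (θ : ℂ), Complex.log (qGamma q z) = G z := by
    filter_upwards [hre, him] with z hz hz'
    rw [qGamma_eq_exp hq0 hq1 hz, Complex.log_exp hz'.1 hz'.2.le]
  filter_upwards [hlog.eventually_nhds, hre] with z hz hz'
  rw [qDigamma, Filter.EventuallyEq.deriv_eq hz, (hGd z hz').deriv]

lemma qDigamma_ofReal_im {q θ : ℝ} (hq0 : 0 < q) (hq1 : q < 1) (hθ : 0 < θ) :
    (qDigamma q θ).im = 0 := by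
  have h : qDigamma q θ = ((-Real.log (1 - q) + Real.log q *
      ∑' k : ℕ, q ^ θ * q ^ k / (1 - q ^ θ * q ^ k) : ℝ) : ℂ) := by
    rw [(qDigamma_eventuallyEq hq0 hq1 hθ).eq_of_nhds]
    push_cast [Complex.ofReal_tsum, Complex.ofReal_cpow hq0.le]
    rfl
  rw [h, Complex.ofReal_im]

lemma hasSum_deriv_qDigamma {q θ : ℝ} (hq0 : 0 < q) (hq1 : q < 1) (hθ : 0 < θ) :
    ∃ s : ℝ, deriv (qDigamma q) θ = s ∧
      HasSum (fun k : ℕ => Real.log q ^ 2 * (q ^ θ * q ^ k / (1 - q ^ θ * q ^ k) ^ 2)) s := by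
  have hz : 0 < (θ : ℂ).re := by simpa using hθ
  have h := (hasSum_deriv_tsum_div_one_sub_cpow hq0 hq1 hz).mul_left (Real.log q : ℂ)
  have hd : deriv (qDigamma q) θ = Real.log q * deriv (fun w : ℂ =>
      ∑' k : ℕ, (q : ℂ) ^ w * (q : ℂ) ^ k / (1 - (q : ℂ) ^ w * (q : ℂ) ^ k)) θ := by
    rw [(qDigamma_eventuallyEq hq0 hq1 hθ).deriv_eq, deriv_const_add, deriv_const_mul_field]
  rw [← hd] at h
  have h' : HasSum (fun k : ℕ =>
      ((Real.log q ^ 2 * (q ^ θ * q ^ k / (1 - q ^ θ * q ^ k) ^ 2) : ℝ) : ℂ))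
      (deriv (qDigamma q) θ) := by
    refine h.congr_fun fun k => ?_
    push_cast [Complex.ofReal_cpow hq0.le]
    ring
  obtain ⟨s, hs⟩ : ∃ s : ℝ, deriv (qDigamma q) θ = s :=
    ⟨_, h'.tsum_eq.symm.trans (Complex.ofReal_tsum _).symm⟩
  rw [hs] at h'
  exact ⟨s, hs, Complex.hasSum_ofReal.1 h'⟩

lemma hasSum_kappaC {q θ : ℝ} (hq0 : 0 < q) (hq1 : q < 1) (hθ : 0 < θ) :
    ∃ κ : ℝ, kappaC q θ = κ ∧
      HasSum (fun k : ℕ => q ^ k / (1 - q ^ θ * q ^ k) ^ 2) κ := by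
  obtain ⟨s, hs, hsum⟩ := hasSum_deriv_qDigamma hq0 hq1 hθ
  have hL : Real.log q ≠ 0 := (Real.log_neg hq0 hq1).ne
  have hqθ : q ^ θ ≠ 0 := (Real.rpow_pos_of_pos hq0 θ).ne'
  refine ⟨s / (Real.log q ^ 2 * q ^ θ), ?_, ?_⟩
  · rw [kappaC, hs]
    push_cast [Complex.ofReal_cpow hq0.le]
    rfl
  · refine (hsum.div_const (Real.log q ^ 2 * q ^ θ)).congr_fun fun k => ?_
    field_simp

lemma fC_im {q θ : ℝ} (hq0 : 0 < q) (hq1 : q < 1) (hθ : 0 < θ) : (fC q θ).im = 0 := by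
  obtain ⟨s, hs, -⟩ := hasSum_deriv_qDigamma hq0 hq1 hθ
  have hd : qDigamma q θ = ((qDigamma q θ).re : ℂ) :=
    Complex.ext rfl (by simp [qDigamma_ofReal_im hq0 hq1 hθ])
  rw [fC, hs, hd]
  norm_cast

/-- The function `a c + ½ log (1 - 2 r c + r²)` is nondecreasing for `c ∈ [-1, 1]`
when `r / (1 - r)² ≤ a`. -/
lemma mul_add_half_log_le {a r c d : ℝ} (hr0 : 0 ≤ r) (hr1 : r < 1)
    (ha : r / (1 - r) ^ 2 ≤ a) (hcd : c ≤ d) (hd : d ≤ 1) :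
    a * c + Real.log (1 - 2 * r * c + r ^ 2) / 2 ≤
      a * d + Real.log (1 - 2 * r * d + r ^ 2) / 2 := by
  have hsq : 0 < (1 - r) ^ 2 := by nlinarith
  have hD : (1 - r) ^ 2 ≤ 1 - 2 * r * d + r ^ 2 := by nlinarith
  have hC : 0 < 1 - 2 * r * c + r ^ 2 := by nlinarith
  have hD0 : 0 < 1 - 2 * r * d + r ^ 2 := hsq.trans_le hD
  have hlog := Real.log_le_sub_one_of_pos (div_pos hC hD0)
  rw [Real.log_div hC.ne' hD0.ne'] at hlog
  have heq : (1 - 2 * r * c + r ^ 2) / (1 - 2 * r * d + r ^ 2) - 1 =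
      2 * (r / (1 - 2 * r * d + r ^ 2)) * (d - c) := by
    field_simp
    ring
  have hle : r / (1 - 2 * r * d + r ^ 2) ≤ a :=
    (div_le_div_of_nonneg_left hr0 hsq hD).trans ha
  have := mul_le_mul_of_nonneg_right hle (sub_nonneg.2 hcd)
  linarith

lemma cpow_add_mul_I {q : ℝ} (hq0 : 0 < q) (x t : ℝ) :
    (q : ℂ) ^ ((x : ℂ) + t * Complex.I) =
      (q ^ x : ℝ) * Complex.exp ((Real.log q * t : ℝ) * Complex.I) := by
  have hq : (q : ℂ) ≠ 0 := by exact_mod_cast hq0.ne'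
  rw [Complex.cpow_add _ _ hq, Complex.ofReal_cpow hq0.le, Complex.cpow_def_of_ne_zero hq (_ * _),
    Complex.ofReal_mul, Complex.ofReal_log hq0.le, mul_assoc]

lemma log_one_sub_mul_exp_re (r φ : ℝ) :
    (Complex.log (1 - r * Complex.exp (φ * Complex.I))).re =
      Real.log (1 - 2 * r * Real.cos φ + r ^ 2) / 2 := by
  have h : ‖1 - r * Complex.exp (φ * Complex.I)‖ ^ 2 = 1 - 2 * r * Real.cos φ + r ^ 2 := by
    rw [Complex.sq_norm, Complex.normSq_apply]
    simp only [Complex.sub_re, Complex.sub_im, Complex.one_re, Complex.one_im,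
      Complex.re_ofReal_mul, Complex.im_ofReal_mul, Complex.exp_ofReal_mul_I_re,
      Complex.exp_ofReal_mul_I_im]
    linear_combination r ^ 2 * Real.sin_sq_add_cos_sq φ
  rw [Complex.log_re, ← h, Real.log_pow]
  push_cast
  ring

lemma f0_re_le_of_cos_le {q θ σ : ℝ} (hq0 : 0 < q) (hq1 : q < 1) (hθ : 0 < θ) (hσ : 0 < σ)
    {t₁ t₂ : ℝ} (h : Real.cos (Real.log q * t₁) ≤ Real.cos (Real.log q * t₂)) :
    (f0 q θ ((θ : ℂ) + (σ : ℂ) + (t₁ : ℂ) * Complex.I)).re ≤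
      (f0 q θ ((θ : ℂ) + (σ : ℂ) + (t₂ : ℂ) * Complex.I)).re := by
  obtain ⟨κ, hκ, hsum⟩ := hasSum_kappaC hq0 hq1 hθ
  have hre : ∀ t : ℝ, 0 < (((θ + σ : ℝ) : ℂ) + t * Complex.I).re := fun t => by
    simpa using add_pos hθ hσ
  have hf0 : ∀ t : ℝ, (f0 q θ ((θ : ℂ) + (σ : ℂ) + (t : ℂ) * Complex.I)).re =
      -(fC q θ).re * Real.log q * (θ + σ) + (κ * (q ^ (θ + σ) * Real.cos (Real.log q * t)) +
        (logPoch q (((θ + σ : ℝ) : ℂ) + t * Complex.I)).re) := by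
    intro t
    have hfC : fC q θ = ((fC q θ).re : ℂ) := Complex.ext rfl (by simp [fC_im hq0 hq1 hθ])
    rw [f0, hκ, hfC, ← Complex.ofReal_add, Complex.add_re, Complex.log_re,
      ← exp_logPoch hq0 hq1 (hre t), Complex.norm_exp, Real.log_exp, cpow_add_mul_I hq0,
      Complex.add_re, Complex.re_ofReal_mul, Complex.re_ofReal_mul, Complex.exp_ofReal_mul_I_re,
      ← Complex.ofReal_neg, ← Complex.ofReal_mul, Complex.re_ofReal_mul, Complex.ofReal_re]
    simp [add_assoc]
  have hS : ∀ t : ℝ, HasSum (fun k : ℕ =>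
      q ^ k / (1 - q ^ θ * q ^ k) ^ 2 * q ^ (θ + σ) * Real.cos (Real.log q * t) +
      Real.log (1 - 2 * (q ^ (θ + σ) * q ^ k) * Real.cos (Real.log q * t)
        + (q ^ (θ + σ) * q ^ k) ^ 2) / 2)
      (κ * (q ^ (θ + σ) * Real.cos (Real.log q * t)) +
        (logPoch q (((θ + σ : ℝ) : ℂ) + t * Complex.I)).re) := by
    intro t
    have h1 := hsum.mul_right (q ^ (θ + σ) * Real.cos (Real.log q * t))
    have h2 := Complex.hasSum_re (summable_log_one_sub_cpow hq0 hq1 (hre t)).hasSum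
    refine (h1.add h2).congr_fun fun k => ?_
    rw [cpow_add_mul_I hq0, ← log_one_sub_mul_exp_re]
    congr 1
    · ring
    · push_cast
      ring_nf
  rw [hf0, hf0]
  gcongr _ + ?_
  refine hasSum_le (fun k => ?_) (hS t₁) (hS t₂)
  have hx : q ^ (θ + σ) ≤ q ^ θ :=
    Real.rpow_le_rpow_of_exponent_ge hq0 hq1.le (by linarith)
  have hx1 : q ^ θ < 1 := Real.rpow_lt_one hq0.le hq1 hθ
  have hk0 : 0 < q ^ k := by positivity
  have hk1 : q ^ k ≤ 1 := pow_le_one₀ hq0.le hq1.le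
  have hle : q ^ (θ + σ) * q ^ k ≤ q ^ θ * q ^ k := by gcongr
  have hθ1 : q ^ θ * q ^ k < 1 :=
    mul_lt_one_of_nonneg_of_lt_one_left (by positivity) hx1 hk1
  refine mul_add_half_log_le (by positivity) (hle.trans_lt hθ1) ?_ h (Real.cos_le_one _)
  rw [div_mul_eq_mul_div, mul_comm (q ^ k)]
  have : 0 < 1 - q ^ θ * q ^ k := by linarith
  gcongr

theorem f0_re_vertical_periodic_monotone (q θ σ : ℝ)
    (hq0 : 0 < q) (hq1 : q < 1) (hθ : 0 < θ) (hσ : 0 < σ) :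
    Function.Periodic (fun t : ℝ => (f0 q θ ((θ : ℂ) + (σ : ℂ) + (t : ℂ) * Complex.I)).re)
        (2 * Real.pi / |Real.log q|)
    ∧ AntitoneOn (fun t : ℝ => (f0 q θ ((θ : ℂ) + (σ : ℂ) + (t : ℂ) * Complex.I)).re)
        (Set.Icc 0 (-Real.pi / Real.log q))
    ∧ MonotoneOn (fun t : ℝ => (f0 q θ ((θ : ℂ) + (σ : ℂ) + (t : ℂ) * Complex.I)).re)
        (Set.Icc (Real.pi / Real.log q) 0) := by
  have hL : Real.log q < 0 := Real.log_neg hq0 hq1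
  refine ⟨fun t => ?_, fun a ha b hb hab => ?_, fun a ha b hb hab => ?_⟩
  · have h : Real.cos (Real.log q * (t + 2 * Real.pi / |Real.log q|)) =
        Real.cos (Real.log q * t) := by
      rw [abs_of_neg hL, show Real.log q * (t + 2 * Real.pi / -Real.log q) =
        Real.log q * t - 2 * Real.pi by
          have := hL.ne
          field_simp
          ring, Real.cos_sub_two_pi]
    exact le_antisymm (f0_re_le_of_cos_le hq0 hq1 hθ hσ h.le)
      (f0_re_le_of_cos_le hq0 hq1 hθ hσ h.ge)
  · refine f0_re_le_of_cos_le hq0 hq1 hθ hσ ?_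
    rw [← Real.cos_neg (_ * a), ← Real.cos_neg (_ * b)]
    have hb' := (le_div_iff_of_neg hL).1 hb.2
    exact Real.cos_le_cos_of_nonneg_of_le_pi (by nlinarith [ha.1]) (by linarith)
      (by nlinarith)
  · refine f0_re_le_of_cos_le hq0 hq1 hθ hσ ?_
    have ha' := (div_le_iff_of_neg hL).1 ha.1
    exact Real.cos_le_cos_of_nonneg_of_le_pi (by nlinarith [hb.2]) (by linarith)
      (by nlinarith)
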